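/- arXiv:2410.23498 — 4 statements merged into one kernel-verified Lean document; each statement's English description precedes it below -/
import Mathlib

section
/- In the kernel ridge regression setup, for every z ∈ Z the ℓ¹ norm of the weight vector satisfies Σ_{i=1}^n |α_{n,i}(z)| ≤ √(n/ρ) · σ_n(z). -/
/- Kernel ridge regression setup: `Z` a nonempty set, `H` a real Hilbert space,
`φ : Z → H` a feature map, kernel `k(z,z') = ⟪φ z, φ z'⟫`. -/

open scoped RealInnerProductSpace
open Matrix

/-- The `n × n` kernel (Gram) matrix of the points `zs`. -/
noncomputable def gramM {Z H : Type*} [NormedAddCommGroup H] [InnerProductSpace ℝ H]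
    (φ : Z → H) {n : ℕ} (zs : Fin n → Z) : Matrix (Fin n) (Fin n) ℝ :=
  Matrix.of fun i j => ⟪φ (zs i), φ (zs j)⟫

/-- The vector `k_n(z) = (k(z, z_1), …, k(z, z_n))`. -/
noncomputable def kvec {Z H : Type*} [NormedAddCommGroup H] [InnerProductSpace ℝ H]
    (φ : Z → H) {n : ℕ} (zs : Fin n → Z) (z : Z) : Fin n → ℝ :=
  fun i => ⟪φ z, φ (zs i)⟫

/-- The kernel ridge regression weight vector `α_n(z) = (K_n + ρ I)⁻¹ k_n(z)`. -/
noncomputable def ridgeWeights {Z H : Type*} [NormedAddCommGroup H] [InnerProductSpace ℝ H]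
    (φ : Z → H) {n : ℕ} (zs : Fin n → Z) (ρ : ℝ) (z : Z) : Fin n → ℝ :=
  (gramM φ zs + ρ • (1 : Matrix (Fin n) (Fin n) ℝ))⁻¹ *ᵥ kvec φ zs z

/-- The kernel ridge uncertainty estimate
`σ_n²(z) = k(z,z) − k_n(z)ᵀ (K_n + ρ I)⁻¹ k_n(z)`. -/
noncomputable def ridgeVar {Z H : Type*} [NormedAddCommGroup H] [InnerProductSpace ℝ H]
    (φ : Z → H) {n : ℕ} (zs : Fin n → Z) (ρ : ℝ) (z : Z) : ℝ :=
  ⟪φ z, φ z⟫ -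
    kvec φ zs z ⬝ᵥ ((gramM φ zs + ρ • (1 : Matrix (Fin n) (Fin n) ℝ))⁻¹ *ᵥ kvec φ zs z)

theorem posSemidef_gramM {Z H : Type*} [NormedAddCommGroup H] [InnerProductSpace ℝ H]
    (φ : Z → H) {n : ℕ} (zs : Fin n → Z) : (gramM φ zs).PosSemidef :=
  Matrix.posSemidef_gram ℝ (fun i => φ (zs i))

/-- The weights solve the regularized normal equations. -/
theorem gramM_mulVec_ridgeWeights {Z H : Type*} [NormedAddCommGroup H] [InnerProductSpace ℝ H]
    (φ : Z → H) {n : ℕ} (zs : Fin n → Z) {ρ : ℝ} (hρ : 0 < ρ) (z : Z) :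
    gramM φ zs *ᵥ ridgeWeights φ zs ρ z + ρ • ridgeWeights φ zs ρ z = kvec φ zs z := by
  have hpos : (gramM φ zs + ρ • (1 : Matrix (Fin n) (Fin n) ℝ)).PosDef :=
    Matrix.PosDef.posSemidef_add (posSemidef_gramM φ zs) (Matrix.PosDef.one.smul hρ)
  have hdet := (Matrix.isUnit_iff_isUnit_det _).mp hpos.isUnit
  have h : (gramM φ zs + ρ • (1 : Matrix (Fin n) (Fin n) ℝ)) *ᵥ ridgeWeights φ zs ρ z
      = kvec φ zs z := by
    rw [ridgeWeights, Matrix.mulVec_mulVec, Matrix.mul_nonsing_inv _ hdet, Matrix.one_mulVec]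
  rwa [Matrix.add_mulVec, Matrix.smul_mulVec, Matrix.one_mulVec] at h

/-- The squared residual of approximating `φ z` by the weighted features is
`σ_n²(z) - ρ ‖α_n(z)‖²`. -/
theorem norm_sub_sum_ridgeWeights_sq {Z H : Type*} [NormedAddCommGroup H]
    [InnerProductSpace ℝ H]
    (φ : Z → H) {n : ℕ} (zs : Fin n → Z) {ρ : ℝ} (hρ : 0 < ρ) (z : Z) :
    ‖φ z - ∑ i, ridgeWeights φ zs ρ z i • φ (zs i)‖ ^ 2
      = ridgeVar φ zs ρ z - ρ * ∑ i, ridgeWeights φ zs ρ z i ^ 2 := by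
  have hnormal := gramM_mulVec_ridgeWeights φ zs hρ z
  have hvar : ridgeVar φ zs ρ z = ⟪φ z, φ z⟫ - kvec φ zs z ⬝ᵥ ridgeWeights φ zs ρ z := rfl
  rw [hvar]
  generalize ridgeWeights φ zs ρ z = a at *
  have hcross : ⟪φ z, ∑ i, a i • φ (zs i)⟫ = kvec φ zs z ⬝ᵥ a := by
    simp [inner_sum, inner_smul_right, dotProduct, kvec, mul_comm]
  have hquad : ⟪∑ i, a i • φ (zs i), ∑ i, a i • φ (zs i)⟫ = a ⬝ᵥ (gramM φ zs *ᵥ a) := by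
    simp only [sum_inner, inner_sum, inner_smul_left, inner_smul_right, dotProduct, mulVec, gramM,
      Matrix.of_apply, Finset.mul_sum, conj_trivial]
    exact Finset.sum_congr rfl fun i _ => Finset.sum_congr rfl fun j _ => by
      rw [real_inner_comm (φ (zs i)) (φ (zs j))]; ring
  have hsq : a ⬝ᵥ a = ∑ i, a i ^ 2 := by simp [dotProduct, sq]
  have hdot := congrArg (fun v => a ⬝ᵥ v) hnormal
  simp only [dotProduct_add, dotProduct_smul, smul_eq_mul, hsq] at hdot
  rw [dotProduct_comm a (kvec φ zs z)] at hdot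
  rw [norm_sub_sq_real, ← real_inner_self_eq_norm_sq, ← real_inner_self_eq_norm_sq, hcross, hquad]
  linarith

/-- The ℓ¹ norm of the kernel ridge weight vector satisfies
`Σ_i |α_{n,i}(z)| ≤ √(n/ρ) ⬝ σ_n(z)`. -/
theorem ridgeWeights_l1_le
    {Z H : Type*} [Nonempty Z] [NormedAddCommGroup H] [InnerProductSpace ℝ H]
    (φ : Z → H) {n : ℕ} (zs : Fin n → Z) (ρ : ℝ) (hρ : 0 < ρ) (z : Z) :
    ∑ i, |ridgeWeights φ zs ρ z i|
      ≤ Real.sqrt ((n : ℝ) / ρ) * Real.sqrt (ridgeVar φ zs ρ z) := by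
  have hres := norm_sub_sum_ridgeWeights_sq φ zs hρ z
  have hridge : ∑ i, ridgeWeights φ zs ρ z i ^ 2 ≤ ridgeVar φ zs ρ z / ρ := by
    rw [le_div_iff₀ hρ]
    linarith [sq_nonneg ‖φ z - ∑ i, ridgeWeights φ zs ρ z i • φ (zs i)‖]
  have hcauchy : (∑ i, |ridgeWeights φ zs ρ z i|) ^ 2 ≤ n * ∑ i, ridgeWeights φ zs ρ z i ^ 2 := by
    simpa using sq_sum_le_card_mul_sum_sq (s := Finset.univ)
      (f := fun i => |ridgeWeights φ zs ρ z i|)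
  rw [← Real.sqrt_mul (by positivity)]
  apply Real.le_sqrt_of_sq_le
  calc (∑ i, |ridgeWeights φ zs ρ z i|) ^ 2
      ≤ n * ∑ i, ridgeWeights φ zs ρ z i ^ 2 := hcauchy
    _ ≤ n * (ridgeVar φ zs ρ z / ρ) := by gcongr
    _ = n / ρ * ridgeVar φ zs ρ z := by ring
end

section
/- In the kernel ridge regression setup, let S be a set, M ∈ ℕ, and suppose for each integer m > M we are given a coefficient w_m ∈ ℝ, an eigenvalue λ_m ≥ 0, a function ψ_m : S → ℝ with |ψ_m(s)| ≤ ψ_max for all s ∈ S, and a function ψ̄_m : Z → ℝ with |ψ̄_m(z)| ≤ ψ_max for all z ∈ Z, where Σ_{m>M} w_m² ≤ C_v² and Σ_{m>M} λ_m < ∞. Then for any points s'_1,…,s'_n ∈ S and any z ∈ Z, Σ_{m=M+1}^∞ |w_m| λ_m^{1/2} · |Σ_{i=1}^n α_{n,i}(z) (ψ_m(s'_i) − ψ̄_m(z_i))| ≤ (2 C_v ψ_max / √ρ) · σ_n(z) · √(n · Σ_{m=M+1}^∞ λ_m). -/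
/- Kernel ridge regression setup: `Z` a nonempty set, `H` a real Hilbert space,
`φ : Z → H` a feature map, kernel `k(z,z') = ⟪φ z, φ z'⟫`. -/

open scoped RealInnerProductSpace
open Matrix

/-- The ridge uncertainty is the squared feature residual plus the penalty of the weights. -/
theorem ridgeVar_eq {Z H : Type*} [NormedAddCommGroup H] [InnerProductSpace ℝ H]
    (φ : Z → H) {n : ℕ} (zs : Fin n → Z) {ρ : ℝ} (hρ : 0 < ρ) (z : Z) :
    ridgeVar φ zs ρ z = ‖φ z - ∑ i, ridgeWeights φ zs ρ z i • φ (zs i)‖ ^ 2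
      + ρ * ∑ i, ridgeWeights φ zs ρ z i ^ 2 := by
  have hnormal := congrArg (fun v => ridgeWeights φ zs ρ z ⬝ᵥ v)
    (gramM_mulVec_ridgeWeights φ zs hρ z)
  have hvar : ridgeVar φ zs ρ z
      = ⟪φ z, φ z⟫ - kvec φ zs z ⬝ᵥ ridgeWeights φ zs ρ z := rfl
  rw [hvar]
  generalize ridgeWeights φ zs ρ z = a at *
  have hcross : ⟪φ z, ∑ i, a i • φ (zs i)⟫ = a ⬝ᵥ kvec φ zs z := by
    simp [inner_sum, inner_smul_right, dotProduct, kvec]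
  have hquad : ⟪∑ i, a i • φ (zs i), ∑ i, a i • φ (zs i)⟫ = a ⬝ᵥ (gramM φ zs *ᵥ a) := by
    simp only [inner_sum, sum_inner, inner_smul_left, inner_smul_right, dotProduct, gramM,
      mulVec, Matrix.of_apply, Finset.mul_sum, RCLike.conj_to_real]
    rw [Finset.sum_comm]
    exact Finset.sum_congr rfl fun i _ => Finset.sum_congr rfl fun j _ => by ring
  have hsq : a ⬝ᵥ a = ∑ i, a i ^ 2 := by simp [dotProduct, sq]
  simp only [dotProduct_add, dotProduct_smul, smul_eq_mul] at hnormal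
  rw [norm_sub_sq_real, ← real_inner_self_eq_norm_sq, ← real_inner_self_eq_norm_sq, hcross,
    hquad, ← hsq, dotProduct_comm (kvec φ zs z)]
  linarith

/-- The `ℓ¹` norm of the ridge weights is controlled by the ridge uncertainty. -/
theorem sum_abs_ridgeWeights_le {Z H : Type*} [NormedAddCommGroup H] [InnerProductSpace ℝ H]
    (φ : Z → H) {n : ℕ} (zs : Fin n → Z) {ρ : ℝ} (hρ : 0 < ρ) (z : Z) :
    ∑ i, |ridgeWeights φ zs ρ z i| ≤
      Real.sqrt n * (Real.sqrt (ridgeVar φ zs ρ z) / Real.sqrt ρ) := by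
  rw [← Real.sqrt_div' _ hρ.le, ← Real.sqrt_mul (Nat.cast_nonneg n)]
  apply Real.le_sqrt_of_sq_le
  have h₁ : (∑ i, |ridgeWeights φ zs ρ z i|) ^ 2 ≤ n * ∑ i, ridgeWeights φ zs ρ z i ^ 2 := by
    simpa using sq_sum_le_card_mul_sum_sq (s := Finset.univ)
      (f := fun i => |ridgeWeights φ zs ρ z i|)
  refine h₁.trans (mul_le_mul_of_nonneg_left ?_ (Nat.cast_nonneg n))
  rw [le_div_iff₀ hρ, ridgeVar_eq φ zs hρ z]
  linarith [sq_nonneg ‖φ z - ∑ i, ridgeWeights φ zs ρ z i • φ (zs i)‖]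

/-- Tail bound for the noise-dependent error term: given coefficients
`w_m`, eigenvalues `λ_m ≥ 0`, uniformly bounded eigenfunctions `ψ_m` on `S` and mean
eigenfunctions `ψ̄_m` on `Z` for `m > M`, with `Σ_{m>M} w_m² ≤ C_v²` and
`Σ_{m>M} λ_m < ∞`, the tail series is bounded by
`(2 C_v ψ_max/√ρ) σ_n(z) √(n Σ_{m>M} λ_m)`. -/
theorem tail_noise_term_bound
    {Z S H : Type*} [Nonempty Z] [NormedAddCommGroup H] [InnerProductSpace ℝ H]
    (φ : Z → H) {n : ℕ} (zs : Fin n → Z) (ρ : ℝ) (hρ : 0 < ρ)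
    (M : ℕ) (wgt lam : ℕ → ℝ) (ψ : ℕ → S → ℝ) (ψbar : ℕ → Z → ℝ)
    (ψmax Cv : ℝ) (hψmax : 0 < ψmax) (hCv : 0 ≤ Cv)
    (hlam : ∀ m, M < m → 0 ≤ lam m)
    (hψ : ∀ m, M < m → ∀ s, |ψ m s| ≤ ψmax)
    (hψbar : ∀ m, M < m → ∀ z, |ψbar m z| ≤ ψmax)
    (hwgt_summable : Summable fun m : {m : ℕ // M < m} => wgt m.1 ^ 2)
    (hwgt : (∑' m : {m : ℕ // M < m}, wgt m.1 ^ 2) ≤ Cv ^ 2)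
    (hlam_summable : Summable fun m : {m : ℕ // M < m} => lam m.1)
    (s' : Fin n → S) (z : Z) :
    (∑' m : {m : ℕ // M < m},
        |wgt m.1| * Real.sqrt (lam m.1) *
          |∑ i, ridgeWeights φ zs ρ z i * (ψ m.1 (s' i) - ψbar m.1 (zs i))|)
      ≤ (2 * Cv * ψmax / Real.sqrt ρ) * Real.sqrt (ridgeVar φ zs ρ z) *
          Real.sqrt ((n : ℝ) * ∑' m : {m : ℕ // M < m}, lam m.1) := by
  set B := 2 * ψmax * (Real.sqrt n * (Real.sqrt (ridgeVar φ zs ρ z) / Real.sqrt ρ)) with hB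
  have hB0 : 0 ≤ B := by positivity
  have hlam0 : ∀ m : {m : ℕ // M < m}, 0 ≤ lam m.1 := fun m => hlam m.1 m.2
  have hterm : ∀ m : {m : ℕ // M < m},
      |∑ i, ridgeWeights φ zs ρ z i * (ψ m.1 (s' i) - ψbar m.1 (zs i))| ≤ B := by
    intro m
    calc |∑ i, ridgeWeights φ zs ρ z i * (ψ m.1 (s' i) - ψbar m.1 (zs i))|
        ≤ ∑ i, |ridgeWeights φ zs ρ z i * (ψ m.1 (s' i) - ψbar m.1 (zs i))| :=
          Finset.abs_sum_le_sum_abs _ _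
      _ ≤ ∑ i, 2 * ψmax * |ridgeWeights φ zs ρ z i| := by
          refine Finset.sum_le_sum fun i _ => ?_
          rw [abs_mul, mul_comm]
          refine mul_le_mul_of_nonneg_right ?_ (abs_nonneg _)
          linarith [abs_sub (ψ m.1 (s' i)) (ψbar m.1 (zs i)), hψ m.1 m.2 (s' i),
            hψbar m.1 m.2 (zs i)]
      _ ≤ B := by
          rw [← Finset.mul_sum]
          exact mul_le_mul_of_nonneg_left (sum_abs_ridgeWeights_le φ zs hρ z) (by positivity)
  have hrhs : (2 * Cv * ψmax / Real.sqrt ρ) * Real.sqrt (ridgeVar φ zs ρ z) *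
      Real.sqrt ((n : ℝ) * ∑' m : {m : ℕ // M < m}, lam m.1)
      = Cv * Real.sqrt (∑' m : {m : ℕ // M < m}, lam m.1) * B := by
    rw [Real.sqrt_mul (Nat.cast_nonneg n), hB]
    ring
  rw [hrhs]
  refine Real.tsum_le_of_sum_le (fun m => by positivity) fun F => ?_
  calc ∑ m ∈ F, |wgt m.1| * Real.sqrt (lam m.1) *
          |∑ i, ridgeWeights φ zs ρ z i * (ψ m.1 (s' i) - ψbar m.1 (zs i))|
      ≤ (∑ m ∈ F, |wgt m.1| * Real.sqrt (lam m.1)) * B := by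
        rw [Finset.sum_mul]
        exact Finset.sum_le_sum fun m _ => mul_le_mul_of_nonneg_left (hterm m) (by positivity)
    _ ≤ Cv * Real.sqrt (∑' m : {m : ℕ // M < m}, lam m.1) * B := by
        refine mul_le_mul_of_nonneg_right ?_ hB0
        refine (Real.sum_mul_le_sqrt_mul_sqrt F _ _).trans ?_
        refine mul_le_mul ?_ ?_ (Real.sqrt_nonneg _) hCv
        · simp only [sq_abs]
          exact Real.sqrt_le_iff.mpr
            ⟨hCv, (hwgt_summable.sum_le_tsum F fun m _ => sq_nonneg _).trans hwgt⟩
        · refine Real.sqrt_le_sqrt ?_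
          simp only [Real.sq_sqrt (hlam0 _)]
          exact hlam_summable.sum_le_tsum F fun m _ => hlam0 m
end

section
/- In the kernel ridge regression setup with a bounded kernel, i.e. k(z,z) ≤ 1 for all z ∈ Z, let w ≥ 1 divide T and fix a sequence z_1,…,z_T ∈ Z; for each t let σ_t² denote the uncertainty estimate built from the first t points (σ_0²(z) = k(z,z)). Let Γ ≥ 0 be any real such that for every subsequence of (z_1,…,z_T) of length T/w, the information gain (1/2) log det(I + ρ⁻¹ K) of that subsequence is at most Γ. Then Σ_{t=1}^{T} σ²_{w⌊(t−1)/w⌋}(z_t) ≤ 2 w Γ / log(1 + 1/ρ). -/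
/- Kernel ridge regression setup: `Z` a nonempty set, `H` a real Hilbert space,
`φ : Z → H` a feature map, kernel `k(z,z') = ⟪φ z, φ z'⟫`. -/

open scoped RealInnerProductSpace
open Matrix

section RidgeVariance

variable {Z H : Type*} [NormedAddCommGroup H] [InnerProductSpace ℝ H]

theorem gramM_add_smul_one_posDef (φ : Z → H) {n : ℕ} (zs : Fin n → Z) {ρ : ℝ} (hρ : 0 < ρ) :
    (gramM φ zs + ρ • (1 : Matrix (Fin n) (Fin n) ℝ)).PosDef :=
  PosDef.posSemidef_add (posSemidef_gram ℝ fun i => φ (zs i)) (PosDef.one.smul hρ)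

/-- The regularized least-squares error of approximating `φ z` by `∑ i, a i • φ (zs i)`. -/
noncomputable def ridgeLoss (φ : Z → H) {n : ℕ} (zs : Fin n → Z) (ρ : ℝ) (z : Z)
    (a : Fin n → ℝ) : ℝ :=
  ‖φ z - ∑ i, a i • φ (zs i)‖ ^ 2 + ρ * ∑ i, a i ^ 2

theorem ridgeLoss_nonneg (φ : Z → H) {n : ℕ} (zs : Fin n → Z) {ρ : ℝ} (hρ : 0 < ρ) (z : Z)
    (a : Fin n → ℝ) : 0 ≤ ridgeLoss φ zs ρ z a := by
  unfold ridgeLoss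
  positivity

theorem ridgeLoss_eq (φ : Z → H) {n : ℕ} (zs : Fin n → Z) (ρ : ℝ) (z : Z) (a : Fin n → ℝ) :
    ridgeLoss φ zs ρ z a = ⟪φ z, φ z⟫ - 2 * (a ⬝ᵥ kvec φ zs z)
      + a ⬝ᵥ ((gramM φ zs + ρ • (1 : Matrix (Fin n) (Fin n) ℝ)) *ᵥ a) := by
  have hcross : ⟪φ z, ∑ i, a i • φ (zs i)⟫ = a ⬝ᵥ kvec φ zs z := by
    simp [inner_sum, inner_smul_right, dotProduct, kvec]
  have hgram : ‖∑ i, a i • φ (zs i)‖ ^ 2 = a ⬝ᵥ (gramM φ zs *ᵥ a) := by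
    rw [← real_inner_self_eq_norm_sq]
    exact (star_dotProduct_gram_mulVec (𝕜 := ℝ) (fun i => φ (zs i)) a a).symm
  have hsq : ∑ i, a i ^ 2 = a ⬝ᵥ a := by simp [dotProduct, sq]
  rw [ridgeLoss, norm_sub_sq_real, hcross, hgram, hsq, ← real_inner_self_eq_norm_sq, add_mulVec,
    smul_mulVec, one_mulVec, dotProduct_add, dotProduct_smul, smul_eq_mul]
  ring

theorem ridgeVar_le_ridgeLoss (φ : Z → H) {n : ℕ} (zs : Fin n → Z) {ρ : ℝ} (hρ : 0 < ρ) (z : Z)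
    (a : Fin n → ℝ) : ridgeVar φ zs ρ z ≤ ridgeLoss φ zs ρ z a := by
  have hpos := gramM_add_smul_one_posDef φ zs hρ
  rw [ridgeLoss_eq, ridgeVar]
  set A := gramM φ zs + ρ • (1 : Matrix (Fin n) (Fin n) ℝ)
  set k := kvec φ zs z
  have hmul : A *ᵥ (A⁻¹ *ᵥ k) = k := by
    rw [mulVec_mulVec, mul_nonsing_inv _ ((isUnit_iff_isUnit_det A).1 hpos.isUnit), one_mulVec]
  have hsymm : (A⁻¹ *ᵥ k) ⬝ᵥ (A *ᵥ a) = a ⬝ᵥ k := by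
    have hT : Aᵀ = A := by simpa [IsHermitian] using hpos.isHermitian
    rw [dotProduct_mulVec, ← mulVec_transpose, hT, hmul, dotProduct_comm]
  have hnonneg := hpos.posSemidef.dotProduct_mulVec_nonneg (a - A⁻¹ *ᵥ k)
  simp only [star_trivial, mulVec_sub, dotProduct_sub, sub_dotProduct, hmul, hsymm] at hnonneg
  rw [dotProduct_comm (A⁻¹ *ᵥ k) k] at hnonneg
  linarith

theorem ridgeLoss_ridgeWeights (φ : Z → H) {n : ℕ} (zs : Fin n → Z) {ρ : ℝ} (hρ : 0 < ρ)
    (z : Z) : ridgeLoss φ zs ρ z (ridgeWeights φ zs ρ z) = ridgeVar φ zs ρ z := by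
  have hpos := gramM_add_smul_one_posDef φ zs hρ
  rw [ridgeLoss_eq, ridgeVar, ridgeWeights, mulVec_mulVec,
    mul_nonsing_inv _ ((isUnit_iff_isUnit_det _).1 hpos.isUnit), one_mulVec,
    dotProduct_comm _ (kvec φ zs z)]
  ring

theorem ridgeVar_nonneg (φ : Z → H) {n : ℕ} (zs : Fin n → Z) {ρ : ℝ} (hρ : 0 < ρ) (z : Z) :
    0 ≤ ridgeVar φ zs ρ z := by
  rw [← ridgeLoss_ridgeWeights φ zs hρ z]
  exact ridgeLoss_nonneg φ zs hρ z _

theorem ridgeVar_le_inner_self (φ : Z → H) {n : ℕ} (zs : Fin n → Z) {ρ : ℝ} (hρ : 0 < ρ)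
    (z : Z) : ridgeVar φ zs ρ z ≤ ⟪φ z, φ z⟫ := by
  simpa [ridgeLoss_eq] using ridgeVar_le_ridgeLoss φ zs hρ z 0

/-- Adding points can only decrease the uncertainty estimate. -/
theorem ridgeVar_le_ridgeVar_comp (φ : Z → H) {m n : ℕ} (zs : Fin n → Z) {ρ : ℝ} (hρ : 0 < ρ)
    (z : Z) {e : Fin m → Fin n} (he : Function.Injective e) :
    ridgeVar φ zs ρ z ≤ ridgeVar φ (fun i => zs (e i)) ρ z := by
  rw [← ridgeLoss_ridgeWeights φ (fun i => zs (e i)) hρ z]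
  set a := ridgeWeights φ (fun i => zs (e i)) ρ z
  refine (ridgeVar_le_ridgeLoss φ zs hρ z (Function.extend e a 0)).trans_eq ?_
  have hcomb : ∑ i, a i • φ (zs (e i)) = ∑ j, Function.extend e a 0 j • φ (zs j) := by
    refine Fintype.sum_of_injective e he _ _ (fun j hj => ?_) fun i => ?_
    · rw [Function.extend_apply' _ _ _ hj, Pi.zero_apply, zero_smul]
    · rw [he.extend_apply]
  have hsq : ∑ i, a i ^ 2 = ∑ j, Function.extend e a 0 j ^ 2 := by
    refine Fintype.sum_of_injective e he _ _ (fun j hj => ?_) fun i => ?_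
    · rw [Function.extend_apply' _ _ _ hj, Pi.zero_apply, zero_pow two_ne_zero]
    · rw [he.extend_apply]
  rw [ridgeLoss, ridgeLoss, hcomb, hsq]

theorem det_gramM_add_smul_one_succ (φ : Z → H) (y : ℕ → Z) {ρ : ℝ} (hρ : 0 < ρ) (n : ℕ) :
    (gramM φ (fun i : Fin (n + 1) => y i) + ρ • (1 : Matrix (Fin (n + 1)) (Fin (n + 1)) ℝ)).det =
      (gramM φ (fun i : Fin n => y i) + ρ • (1 : Matrix (Fin n) (Fin n) ℝ)).det *
        (ρ + ridgeVar φ (fun i : Fin n => y i) ρ (y n)) := by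
  have hpos := gramM_add_smul_one_posDef φ (fun i : Fin n => y i) hρ
  set A := gramM φ (fun i : Fin n => y i) + ρ • (1 : Matrix (Fin n) (Fin n) ℝ) with hA
  set k := kvec φ (fun i : Fin n => y i) (y n) with hk
  have : Invertible A := A.invertibleOfIsUnitDet ((isUnit_iff_isUnit_det A).1 hpos.isUnit)
  have hblocks :
      (gramM φ (fun i : Fin (n + 1) => y i) +
        ρ • (1 : Matrix (Fin (n + 1)) (Fin (n + 1)) ℝ)).submatrix
          (finSumFinEquiv (m := n) (n := 1)) (finSumFinEquiv (m := n) (n := 1)) =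
      fromBlocks A (replicateCol (Fin 1) k) (replicateRow (Fin 1) k)
        (of fun _ _ => ⟪φ (y n), φ (y n)⟫ + ρ) := by
    ext (i | i) (j | j)
    · simp [hA, gramM, one_apply, Fin.ext_iff]
    · simp [hk, gramM, kvec, one_apply, Fin.ext_iff, real_inner_comm, i.2.ne]
    · simp [hk, gramM, kvec, one_apply, Fin.ext_iff, j.2.ne']
    · simp [gramM, one_apply, Subsingleton.elim i j]
  rw [← det_submatrix_equiv_self (finSumFinEquiv (m := n) (n := 1)), hblocks, det_fromBlocks₁₁,
    invOf_eq_nonsing_inv, det_fin_one]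
  congr 1
  rw [ridgeVar, ← hA, ← hk, dotProduct_mulVec]
  simp only [Matrix.sub_apply, of_apply, mul_apply, replicateRow_apply, replicateCol_apply, dotProduct,
    vecMul]
  ring

/-- The log-determinant of the kernel matrix as a sum of sequential uncertainty estimates. -/
theorem log_det_one_add_gramM (φ : Z → H) (y : ℕ → Z) {ρ : ℝ} (hρ : 0 < ρ) (n : ℕ) :
    Real.log (1 + ρ⁻¹ • gramM φ (fun i : Fin n => y i)).det =
      ∑ i ∈ Finset.range n, Real.log (1 + ridgeVar φ (fun j : Fin i => y j) ρ (y i) * (1 / ρ)) := by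
  have hdet : (1 + ρ⁻¹ • gramM φ (fun i : Fin n => y i)).det =
      ∏ i ∈ Finset.range n, (1 + ridgeVar φ (fun j : Fin i => y j) ρ (y i) * (1 / ρ)) := by
    have hscale (n : ℕ) : 1 + ρ⁻¹ • gramM φ (fun i : Fin n => y i) =
        ρ⁻¹ • (gramM φ (fun i : Fin n => y i) + ρ • (1 : Matrix (Fin n) (Fin n) ℝ)) := by
      rw [smul_add, smul_smul, inv_mul_cancel₀ hρ.ne', one_smul, add_comm]
    induction n with
    | zero => simp
    | succ n ih =>
      rw [Finset.prod_range_succ, ← ih, hscale, hscale, det_smul, det_smul,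
        det_gramM_add_smul_one_succ φ y hρ, Fintype.card_fin, Fintype.card_fin]
      have hfactor : 1 + ridgeVar φ (fun j : Fin n => y j) ρ (y n) * (1 / ρ) =
          ρ⁻¹ * (ρ + ridgeVar φ (fun j : Fin n => y j) ρ (y n)) := by
        field_simp
      rw [hfactor]
      ring
  rw [hdet, Real.log_prod]
  intro i _
  have := ridgeVar_nonneg φ (fun j : Fin i => y j) hρ (y i)
  positivity

end RidgeVariance

theorem mul_log_one_add_le {x s : ℝ} (hx₀ : 0 ≤ x) (hx₁ : x ≤ 1) (hs : 0 < s) :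
    x * Real.log (1 + s) ≤ Real.log (1 + x * s) := by
  have h := strictConcaveOn_log_Ioi.concaveOn.2 (x := 1) (y := 1 + s) (Set.mem_Ioi.2 one_pos)
    (Set.mem_Ioi.2 (by positivity)) (sub_nonneg.2 hx₁) hx₀ (sub_add_cancel 1 x)
  simp only [smul_eq_mul, Real.log_one, mul_zero, zero_add] at h
  have hcomb : (1 - x) * 1 + x * (1 + s) = 1 + x * s := by ring
  rwa [hcomb] at h

theorem sum_range_mul_eq_sum_sum {M : Type*} [AddCommMonoid M] (f : ℕ → M) (w q : ℕ) :
    ∑ t ∈ Finset.range (w * q), f t =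
      ∑ r ∈ Finset.range w, ∑ b ∈ Finset.range q, f (w * b + r) := by
  rw [Finset.sum_comm]
  induction q with
  | zero => simp
  | succ q ih => rw [Nat.mul_succ, Finset.sum_range_add, ih, Finset.sum_range_succ]

/-- (Sum of delayed posterior variances.) For a bounded kernel
(`k(z,z) ≤ 1`), window size `w ≥ 1` dividing `T`, and `Γ ≥ 0` dominating the
information gain of every length-`T/w` subsequence of `(z_1,…,z_T)`, the sum of
posterior variances with delayed (blockwise) updates satisfies
`Σ_{t=1}^{T} σ²_{w⌊(t−1)/w⌋}(z_t) ≤ 2wΓ/log(1+1/ρ)`.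
The sequence is 0-indexed: `zseq t` is the paper's `z_{t+1}`, so the delayed
uncertainty estimate at step `t` uses the first `w * (t / w)` points. -/
theorem sum_delayed_ridgeVar_le
    {Z H : Type*} [Nonempty Z] [NormedAddCommGroup H] [InnerProductSpace ℝ H]
    (φ : Z → H) (ρ : ℝ) (hρ : 0 < ρ)
    (hk : ∀ z : Z, ⟪φ z, φ z⟫ ≤ 1)
    (T w : ℕ) (hw : 1 ≤ w) (hdvd : w ∣ T) (zseq : ℕ → Z)
    (Γ : ℝ) (hΓ : 0 ≤ Γ)
    (hsub : ∀ g : Fin (T / w) → Fin T, StrictMono g →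
      (1 / 2) * Real.log ((1 + ρ⁻¹ • gramM φ (fun i => zseq (g i))).det) ≤ Γ) :
    ∑ t ∈ Finset.range T, ridgeVar φ (fun i : Fin (w * (t / w)) => zseq i) ρ (zseq t)
      ≤ 2 * w * Γ / Real.log (1 + 1 / ρ) := by
  obtain ⟨q, rfl⟩ := hdvd
  rw [Nat.mul_div_cancel_left q hw] at hsub
  have hlog : 0 < Real.log (1 + 1 / ρ) := Real.log_pos (by simpa using hρ)
  rw [le_div_iff₀ hlog, sum_range_mul_eq_sum_sum, Finset.sum_mul]
  have hresidue : ∀ r ∈ Finset.range w,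
      (∑ b ∈ Finset.range q, ridgeVar φ
        (fun i : Fin (w * ((w * b + r) / w)) => zseq i) ρ (zseq (w * b + r))) *
          Real.log (1 + 1 / ρ) ≤ 2 * Γ := by
    intro r hr
    have hrw : r < w := Finset.mem_range.1 hr
    have hlt {b c : ℕ} (hbc : b < c) : w * b + r < w * c := by nlinarith
    set y : ℕ → Z := fun b => zseq (w * b + r)
    have hgain := hsub (fun b => ⟨w * b + r, hlt b.2⟩) fun b c hbc =>
      Fin.mk_lt_mk.2 (Nat.add_lt_add_right (Nat.mul_lt_mul_of_pos_left hbc hw) r)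
    have hsum := log_det_one_add_gramM φ y hρ q
    have hle : (∑ b ∈ Finset.range q, ridgeVar φ
        (fun i : Fin (w * ((w * b + r) / w)) => zseq i) ρ (zseq (w * b + r))) *
          Real.log (1 + 1 / ρ) ≤ Real.log (1 + ρ⁻¹ • gramM φ (fun i : Fin q => y i)).det := by
      rw [hsum, Finset.sum_mul]
      refine Finset.sum_le_sum fun b _ => ?_
      have hdiv : (w * b + r) / w = b := by
        rw [Nat.mul_add_div hw, Nat.div_eq_of_lt hrw, add_zero]
      rw [hdiv]
      have hmono := ridgeVar_le_ridgeVar_comp φ (fun i : Fin (w * b) => zseq i) hρ (y b)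
        (e := fun j : Fin b => ⟨w * j + r, hlt j.2⟩) fun j j' hjj' => by
          have h := congrArg Fin.val hjj'
          exact Fin.ext (Nat.eq_of_mul_eq_mul_left hw (Nat.add_right_cancel h))
      exact (mul_le_mul_of_nonneg_right hmono hlog.le).trans
        (mul_log_one_add_le (ridgeVar_nonneg φ _ hρ _)
          ((ridgeVar_le_inner_self φ _ hρ _).trans (hk _)) (one_div_pos.2 hρ))
    change 1 / 2 * Real.log (1 + ρ⁻¹ • gramM φ (fun i : Fin q => y i)).det ≤ Γ at hgain
    linarith
  calc _ ≤ ∑ _r ∈ Finset.range w, 2 * Γ := Finset.sum_le_sum hresidue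
    _ = 2 * w * Γ := by
      rw [Finset.sum_const, Finset.card_range, nsmul_eq_mul]
      ring
end

section
/- Fix w ∈ ℕ, w ≥ 1, and let q_1,…,q_w : S×A → ℝ and v_1,…,v_{w+1} : S → ℝ be bounded measurable functions such that v_{w+1} ≡ 0, v_j(s) = max_{a∈A} q_j(s,a) for all j ≤ w and s ∈ S, and the optimism condition q_j(s,a) ≥ min( w, r(s,a) + [P v_{j+1}](s,a) ) holds for all j ≤ w, s ∈ S, a ∈ A. Then for every 0 ≤ j ≤ w and every s ∈ S, V*_j(s) ≤ v_{w+1−j}(s); in particular V*_w(s) ≤ v_1(s) for all s ∈ S. -/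
/- MDP setup: `S` a measurable state space, `A` a nonempty finite action set,
`r : S × A → [0,1]` a measurable reward, `P` a Markov kernel from `S × A` to `S`.
For bounded measurable `v : S → ℝ`, `[Pv](s,a) = ∫ v(s') dP(s'|s,a)`. -/

open MeasureTheory ProbabilityTheory

/-- The optimal `j`-step value functions: `V*_0 ≡ 0` and
`V*_{j+1}(s) = max_a (r(s,a) + [P V*_j](s,a))`. -/
noncomputable def Vstar {S A : Type*} [MeasurableSpace S] [MeasurableSpace A]
    [Fintype A] [Nonempty A]
    (P : Kernel (S × A) S) (r : S × A → ℝ) : ℕ → S → ℝ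
  | 0 => fun _ => 0
  | j + 1 => fun s => ⨆ a : A, (r (s, a) + ∫ s', Vstar P r j s' ∂(P (s, a)))

section VstarBounds

variable {S A : Type*} [MeasurableSpace S] [MeasurableSpace A] [Fintype A] [Nonempty A]
  {P : Kernel (S × A) S} {r : S × A → ℝ}

lemma measurable_Vstar (hr : Measurable r) (j : ℕ) : Measurable (Vstar P r j) := by
  induction j with
  | zero => exact measurable_const
  | succ j ih =>
    have hP : Measurable fun z : S × A => ∫ s', Vstar P r j s' ∂(P z) :=
      (ih.stronglyMeasurable.integral_kernel (κ := P)).measurable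
    exact Measurable.iSup fun a => (hr.add hP).comp measurable_prodMk_right

lemma Vstar_mem_Icc [IsMarkovKernel P] (hr : Measurable r)
    (hr01 : ∀ z, r z ∈ Set.Icc (0 : ℝ) 1) (j : ℕ) (s : S) :
    Vstar P r j s ∈ Set.Icc (0 : ℝ) j := by
  induction j generalizing s with
  | zero => simp [Vstar]
  | succ j ih =>
    have hle (a : A) : ∫ s', Vstar P r j s' ∂(P (s, a)) ≤ j := by
      have hint : Integrable (Vstar P r j) (P (s, a)) :=
        .of_mem_Icc 0 j (measurable_Vstar hr j).aemeasurable (.of_forall ih)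
      simpa using integral_mono hint (integrable_const (j : ℝ)) fun s' => (ih s').2
    refine ⟨Real.iSup_nonneg fun a => add_nonneg (hr01 _).1 (integral_nonneg fun s' => (ih s').1),
      ciSup_le fun a => ?_⟩
    push_cast
    linarith [hle a, (hr01 (s, a)).2]

end VstarBounds

/-- (Optimism, Lemma 2 of the paper.) If `v_{w+1} ≡ 0`, each
`v_j(s) = max_a q_j(s,a)`, and the proxies are optimistic:
`q_j(s,a) ≥ min(w, r(s,a) + [P v_{j+1}](s,a))` for all `1 ≤ j ≤ w`, then
`V*_j(s) ≤ v_{w+1−j}(s)` for all `0 ≤ j ≤ w`; in particular `V*_w ≤ v_1`. -/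
theorem optimism_dominates_Vstar
    {S A : Type*} [MeasurableSpace S] [MeasurableSpace A] [Fintype A] [Nonempty A]
    (r : S × A → ℝ) (hr_meas : Measurable r) (hr01 : ∀ z, r z ∈ Set.Icc (0 : ℝ) 1)
    (P : Kernel (S × A) S) [IsMarkovKernel P]
    (w : ℕ) (hw : 1 ≤ w)
    (q : ℕ → S × A → ℝ) (v : ℕ → S → ℝ)
    (hq_meas : ∀ j, 1 ≤ j → j ≤ w → Measurable (q j))
    (hv_meas : ∀ j, 1 ≤ j → j ≤ w + 1 → Measurable (v j))
    (Cb : ℝ)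
    (hq_bdd : ∀ j, 1 ≤ j → j ≤ w → ∀ z, |q j z| ≤ Cb)
    (hv_bdd : ∀ j, 1 ≤ j → j ≤ w + 1 → ∀ s, |v j s| ≤ Cb)
    (hv_top : ∀ s, v (w + 1) s = 0)
    (hv_max : ∀ j, 1 ≤ j → j ≤ w → ∀ s, v j s = ⨆ a : A, q j (s, a))
    (hopt : ∀ j, 1 ≤ j → j ≤ w → ∀ s a,
      min (w : ℝ) (r (s, a) + ∫ s', v (j + 1) s' ∂(P (s, a))) ≤ q j (s, a)) :
    (∀ j ≤ w, ∀ s, Vstar P r j s ≤ v (w + 1 - j) s)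
    ∧ ∀ s, Vstar P r w s ≤ v 1 s := by
  have hmain : ∀ j ≤ w, ∀ s, Vstar P r j s ≤ v (w + 1 - j) s := by
    intro j
    induction j with
    | zero => intro _ s; simp [Vstar, hv_top]
    | succ j ih =>
      intro hj s
      have hidx : w + 1 - (j + 1) + 1 = w + 1 - j := by omega
      rw [hv_max _ (by omega) (by omega)]
      refine ciSup_mono (Set.finite_range _).bddAbove fun a => ?_
      refine le_trans (le_min ?_ ?_) (hopt _ (by omega) (by omega) s a)
      · have hV := Vstar_mem_Icc (P := P) hr_meas hr01 (j + 1) s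
        refine le_trans (le_ciSup (f := fun a => r (s, a) + ∫ s', Vstar P r j s' ∂(P (s, a)))
          (Set.finite_range _).bddAbove a) (hV.2.trans ?_)
        exact_mod_cast hj
      · rw [hidx]
        gcongr
        · exact .of_mem_Icc 0 j (measurable_Vstar hr_meas j).aemeasurable
            (.of_forall (Vstar_mem_Icc hr_meas hr01 j))
        · exact .of_mem_Icc (-Cb) Cb (hv_meas _ (by omega) (by omega)).aemeasurable
            (.of_forall fun s' => abs_le.1 (hv_bdd _ (by omega) (by omega) s'))
        · exact fun s' => ih (by omega) s'
  exact ⟨hmain, fun s => by simpa using hmain w le_rfl s⟩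
end
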